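/- arXiv:2403.16388 — 5 statements merged into one kernel-verified Lean document; each statement's English description precedes it below -/
import Mathlib

section
/- Let P : E → X be a Grothendieck fibration. Then the class of vertical morphisms (those sent by P to isomorphisms) and the class of cartesian morphisms form an orthogonal factorization system on E: every morphism of E factors as a vertical morphism followed by a cartesian morphism, uniquely up to unique isomorphism, and vertical morphisms are left orthogonal to cartesian morphisms. -/
open CategoryTheory

/-- A functor `p : 𝒳 ⥤ 𝒮` is a Grothendieck fibration if every morphism
`f : R ⟶ p(a)` in the base admits a (strongly) cartesian lift into `a`. -/
def IsFibration {𝒳 𝒮 : Type*} [Category 𝒳] [Category 𝒮] (p : 𝒳 ⥤ 𝒮) : Prop :=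
  ∀ {a : 𝒳} {R : 𝒮} (f : R ⟶ p.obj a),
    ∃ (b : 𝒳) (φ : b ⟶ a), Functor.IsStronglyCartesian p f φ

variable {𝒳 𝒮 : Type*} [Category 𝒳] [Category 𝒮]

/-- A morphism is vertical for `P` when `P` sends it to an isomorphism. -/
def IsVertical (P : 𝒳 ⥤ 𝒮) {A B : 𝒳} (v : A ⟶ B) : Prop :=
  IsIso (P.map v)

/-- A morphism is cartesian for `P` when it is (strongly) cartesian over its own
image under `P`. -/
def IsCartesianMor (P : 𝒳 ⥤ 𝒮) {A B : 𝒳} (c : A ⟶ B) : Prop :=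
  Functor.IsStronglyCartesian P (P.map c) c

lemma isCartesianMor_of (P : 𝒳 ⥤ 𝒮) {A B : 𝒳} {R S : 𝒮} (f : R ⟶ S) (c : A ⟶ B)
    (h : Functor.IsStronglyCartesian P f c) : IsCartesianMor P c := by
  obtain ⟨⟩ := (inferInstance : P.IsHomLift f c)
  exact h

/-- For a Grothendieck fibration `P : 𝒳 ⥤ 𝒮`, the vertical morphisms (those sent
by `P` to isomorphisms) and the cartesian morphisms form an orthogonal
factorization system on `𝒳`: both classes contain the isomorphisms and are closed
under composition, every morphism factors as a vertical morphism followed by a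
cartesian one, and vertical morphisms are left orthogonal to cartesian morphisms
(unique diagonal fillers, whence the factorization is unique up to unique
isomorphism). -/
theorem vertical_cartesian_OFS (P : 𝒳 ⥤ 𝒮) (hP : IsFibration P) :
    -- both classes contain isomorphisms and are closed under composition
    (∀ {A B : 𝒳} (φ : A ⟶ B), IsIso φ → IsVertical P φ ∧ IsCartesianMor P φ) ∧
    (∀ {A B C : 𝒳} (φ : A ⟶ B) (ψ : B ⟶ C),
      IsVertical P φ → IsVertical P ψ → IsVertical P (φ ≫ ψ)) ∧
    (∀ {A B C : 𝒳} (φ : A ⟶ B) (ψ : B ⟶ C),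
      IsCartesianMor P φ → IsCartesianMor P ψ → IsCartesianMor P (φ ≫ ψ)) ∧
    -- every morphism factors as a vertical morphism followed by a cartesian one
    (∀ {A B : 𝒳} (φ : A ⟶ B), ∃ (M : 𝒳) (v : A ⟶ M) (c : M ⟶ B),
      IsVertical P v ∧ IsCartesianMor P c ∧ v ≫ c = φ) ∧
    -- vertical morphisms are (uniquely) left orthogonal to cartesian morphisms
    (∀ {A B M N : 𝒳} (v : A ⟶ B) (c : M ⟶ N), IsVertical P v → IsCartesianMor P c →
      ∀ (t : A ⟶ M) (b : B ⟶ N), t ≫ c = v ≫ b →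
        ∃! d : B ⟶ M, v ≫ d = t ∧ d ≫ c = b) := by
  refine ⟨?_, ?_, ?_, ?_, ?_⟩
  · intro A B φ hφ
    refine ⟨?_, ?_⟩
    · unfold IsVertical
      infer_instance
    · unfold IsCartesianMor
      infer_instance
  · intro A B C φ ψ h1 h2
    unfold IsVertical at *
    rw [P.map_comp]
    infer_instance
  · intro A B C φ ψ h1 h2
    unfold IsCartesianMor at *
    rw [P.map_comp]
    infer_instance
  · intro A B φ
    obtain ⟨M, c, hc⟩ := hP (P.map φ)
    have hl := Functor.IsStronglyCartesian.map_isHomLift P (P.map φ) c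
      (Category.id_comp (P.map φ)).symm φ
    refine ⟨M, Functor.IsStronglyCartesian.map P (P.map φ) c
      (Category.id_comp (P.map φ)).symm φ, c, ?_, isCartesianMor_of P _ c hc,
      Functor.IsStronglyCartesian.fac P (P.map φ) c _ φ⟩
    unfold IsVertical
    rw [IsHomLift.fac' P (𝟙 (P.obj A)) (Functor.IsStronglyCartesian.map P (P.map φ) c
      (Category.id_comp (P.map φ)).symm φ)]
    infer_instance
  · intro A B M N v c hv hc t b h
    unfold IsVertical at hv
    unfold IsCartesianMor at hc
    have hb : P.map b = (inv (P.map v) ≫ P.map t) ≫ P.map c := by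
      rw [Category.assoc, ← P.map_comp, h, P.map_comp, IsIso.inv_hom_id_assoc]
    obtain ⟨d, ⟨hd1, hd2⟩, hu⟩ := Functor.IsStronglyCartesian.universal_property P (P.map c) c
      (inv (P.map v) ≫ P.map t) (P.map b) hb b
    refine ⟨d, ⟨?_, hd2⟩, ?_⟩
    · have h1 : P.IsHomLift (P.map t) (v ≫ d) := by
        have := IsHomLift.comp P (P.map v) (inv (P.map v) ≫ P.map t) v d
        rwa [IsIso.hom_inv_id_assoc] at this
      exact Functor.IsStronglyCartesian.ext P (P.map c) c (P.map t)
        (by rw [Category.assoc, hd2, h])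
    · rintro e ⟨he1, he2⟩
      refine hu e ⟨?_, he2⟩
      rw [← he1, P.map_comp, IsIso.inv_hom_id_assoc]
      infer_instance
end

section
/- Let P : E → X be a Grothendieck fibration. Then every cospan in E consisting of a cartesian morphism c : A → D and a vertical morphism v : B → D into the same object D admits a pullback in E; moreover the pullback square has a vertical morphism opposite v and a cartesian morphism opposite c. -/
open CategoryTheory

theorem cvp_lift_cancel {𝒳 𝒮 : Type*} [Category 𝒳] [Category 𝒮] (P : 𝒳 ⥤ 𝒮)
    {a b d : 𝒳} {R S T : 𝒮} (y : a ⟶ b) (v : b ⟶ d) (f : R ⟶ S)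
    (hv : P.IsHomLift (𝟙 T) v) (h : P.IsHomLift f (y ≫ v)) : P.IsHomLift f y := by
  have hb := IsHomLift.domain_eq P (𝟙 T) v
  have hd := IsHomLift.codomain_eq P (𝟙 T) v
  have ha := IsHomLift.domain_eq P f (y ≫ v)
  have hd' := IsHomLift.codomain_eq P f (y ≫ v)
  have e1 := IsHomLift.fac' P (𝟙 T) v
  have e2 := IsHomLift.fac P f (y ≫ v)
  refine IsHomLift.of_fac P f y ha (hb.trans (hd.symm.trans hd')) ?_
  rw [e2, P.map_comp, e1]
  simp

theorem cvp_self {𝒳 𝒮 : Type*} [Category 𝒳] [Category 𝒮] (P : 𝒳 ⥤ 𝒮)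
    {a b : 𝒳} {R S : 𝒮} (f : R ⟶ S) (φ : a ⟶ b) (h : P.IsStronglyCartesian f φ) :
    P.IsStronglyCartesian (P.map φ) φ := by
  subst_hom_lift P f φ
  exact h

theorem cvp_exists {𝒳 𝒮 : Type*} [Category 𝒳] [Category 𝒮] (P : 𝒳 ⥤ 𝒮)
    (hP : IsFibration P) {a : 𝒳} {R S : 𝒮} (ha : P.obj a = S) (f : R ⟶ S) :
    ∃ (b : 𝒳) (φ : b ⟶ a), P.IsStronglyCartesian f φ := by
  subst ha; exact hP f

/-- For a Grothendieck fibration `P : 𝒳 ⥤ 𝒮`, every cospan consisting of a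
cartesian morphism `c : A ⟶ D` and a vertical morphism `v : B ⟶ D` (one projected
by `P` to an identity) admits a pullback in `𝒳`, whose projection opposite `v` is
vertical and whose projection opposite `c` is cartesian. -/
theorem cartesian_vertical_pullback {𝒳 𝒮 : Type*} [Category 𝒳] [Category 𝒮]
    (P : 𝒳 ⥤ 𝒮) (hP : IsFibration P) {A B D : 𝒳} (c : A ⟶ D) (v : B ⟶ D)
    (hc : Functor.IsStronglyCartesian P (P.map c) c)
    (hv : P.IsHomLift (𝟙 (P.obj D)) v) :
    ∃ (W : 𝒳) (p₁ : W ⟶ A) (p₂ : W ⟶ B),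
      IsPullback p₁ p₂ c v ∧
      P.IsHomLift (𝟙 (P.obj A)) p₁ ∧
      Functor.IsStronglyCartesian P (P.map p₂) p₂ := by
  obtain ⟨W, p₂, hp₂⟩ := cvp_exists P hP (IsHomLift.domain_eq P (𝟙 (P.obj D)) v) (P.map c)
  obtain ⟨p₁, ⟨hp₁, e⟩, -⟩ := Functor.IsStronglyCartesian.universal_property P (P.map c) c
    (𝟙 (P.obj A)) (P.map c) (by simp) (p₂ ≫ v)
  refine ⟨W, p₁, p₂, ⟨⟨e⟩, ⟨Limits.PullbackCone.IsLimit.mk e ?_ ?_ ?_ ?_⟩⟩, hp₁,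
    cvp_self P _ _ hp₂⟩
  all_goals
    have key : ∀ s : Limits.PullbackCone c v, ∃ u : s.pt ⟶ W, (u ≫ p₁ = s.fst ∧ u ≫ p₂ = s.snd) ∧
        ∀ m : s.pt ⟶ W, m ≫ p₁ = s.fst → m ≫ p₂ = s.snd → m = u := by
      intro s
      have hy : P.IsHomLift (P.map s.fst ≫ P.map c) s.snd := by
        apply cvp_lift_cancel P s.snd v _ hv
        rw [← s.condition]
        infer_instance
      obtain ⟨u, ⟨hu, eu⟩, uu⟩ := Functor.IsStronglyCartesian.universal_property P (P.map c) p₂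
        (P.map s.fst) _ rfl s.snd
      refine ⟨u, ⟨?_, eu⟩, ?_⟩
      · have : P.IsHomLift (P.map s.fst) (u ≫ p₁) := inferInstance
        apply Functor.IsStronglyCartesian.ext P (P.map c) c (P.map s.fst)
        rw [Category.assoc, e, ← Category.assoc, eu, s.condition]
      · intro m h1 h2
        refine uu m ⟨?_, h2⟩
        apply cvp_lift_cancel P m p₁ _ hp₁
        rw [h1]
        infer_instance
  · exact fun s => (key s).choose
  · exact fun s => (key s).choose_spec.1.1
  · exact fun s => (key s).choose_spec.1.2
  · exact fun s => (key s).choose_spec.2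
end

section
/- Let P : E → X be a Grothendieck fibration. Then every commutative square in E whose two parallel horizontal morphisms are cartesian and whose two parallel vertical-side morphisms are vertical (i.e., projected by P to identities) is a pullback square in E. -/
open CategoryTheory

/-- For a Grothendieck fibration `P : 𝒳 ⥤ 𝒮`, every commutative square whose two
parallel horizontal morphisms are cartesian and whose two parallel vertical-side
morphisms are vertical (projected by `P` to identities) is a pullback square. -/
theorem cartesian_vertical_square_isPullback {𝒳 𝒮 : Type*} [Category 𝒳] [Category 𝒮]
    (P : 𝒳 ⥤ 𝒮) (hP : IsFibration P) {W A B D : 𝒳}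
    (c₁ : W ⟶ B) (c₂ : A ⟶ D) (v₁ : W ⟶ A) (v₂ : B ⟶ D)
    (hc₁ : Functor.IsStronglyCartesian P (P.map c₁) c₁)
    (hc₂ : Functor.IsStronglyCartesian P (P.map c₂) c₂)
    (hv₁ : P.IsHomLift (𝟙 (P.obj A)) v₁)
    (hv₂ : P.IsHomLift (𝟙 (P.obj D)) v₂)
    (comm : c₁ ≫ v₂ = v₁ ≫ c₂) :
    IsPullback c₁ v₁ v₂ c₂ := by
  have i₁ : IsIso (P.map v₁) := by
    rw [IsHomLift.fac' P (𝟙 (P.obj A)) v₁]; infer_instance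
  have i₂ : IsIso (P.map v₂) := by
    rw [IsHomLift.fac' P (𝟙 (P.obj D)) v₂]; infer_instance
  have hcomm : P.map c₁ ≫ P.map v₂ = P.map v₁ ≫ P.map c₂ := by
    rw [← P.map_comp, comm, P.map_comp]
  -- morphisms into the source of a cartesian arrow are determined by projection and composite
  have ext₀ : ∀ {T X Y : 𝒳} (c : X ⟶ Y) (_ : Functor.IsStronglyCartesian P (P.map c) c)
      (s t : T ⟶ X), P.map s = P.map t → s ≫ c = t ≫ c → s = t := by
    intro T X Y c hc s t h h'
    have hl : P.IsHomLift (P.map t ≫ P.map c) (t ≫ c) := by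
      rw [← P.map_comp]; infer_instance
    refine (hc.universal_property' (P.map t) (t ≫ c)).unique ⟨?_, h'⟩ ⟨inferInstance, rfl⟩
    rw [← h]; infer_instance
  have lift₀ : ∀ {T : 𝒳} (b : T ⟶ B) (a : T ⟶ A), b ≫ v₂ = a ≫ c₂ →
      ∃ l : T ⟶ W, l ≫ c₁ = b ∧ l ≫ v₁ = a := by
    intro T b a w
    have hg : (P.map a ≫ inv (P.map v₁)) ≫ P.map c₁ = P.map b := by
      rw [← cancel_mono (P.map v₂), Category.assoc, Category.assoc, hcomm,
        IsIso.inv_hom_id_assoc, ← P.map_comp, ← P.map_comp, w]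
    have hl : P.IsHomLift ((P.map a ≫ inv (P.map v₁)) ≫ P.map c₁) b := by
      rw [hg]; infer_instance
    obtain ⟨l, ⟨h₁, h₂⟩, -⟩ := hc₁.universal_property' (P.map a ≫ inv (P.map v₁)) b
    have h₃ := IsHomLift.eq_of_isHomLift P (P.map a ≫ inv (P.map v₁)) l
    refine ⟨l, h₂, ext₀ c₂ hc₂ _ _ ?_ ?_⟩
    · rw [P.map_comp, ← h₃, Category.assoc, IsIso.inv_hom_id, Category.comp_id]
    · rw [Category.assoc, ← comm, ← Category.assoc, h₂, w]
  refine ⟨⟨comm⟩, ⟨Limits.PullbackCone.IsLimit.mk comm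
    (fun s => (lift₀ s.fst s.snd s.condition).choose)
    (fun s => (lift₀ s.fst s.snd s.condition).choose_spec.1)
    (fun s => (lift₀ s.fst s.snd s.condition).choose_spec.2) ?_⟩⟩
  intro s m h₁ h₂
  have hs := (lift₀ s.fst s.snd s.condition).choose_spec
  refine ext₀ c₁ hc₁ _ _ ?_ (h₁.trans hs.1.symm)
  rw [← cancel_mono (P.map v₁), ← P.map_comp, ← P.map_comp, h₂, hs.2]
end

section
/- Let P : E → X be a Grothendieck fibration. Define E^∨ to have the same objects as E and, as morphisms E → D, equivalence classes of spans in E with left leg vertical and right leg cartesian (equivalently, pairs (f : P(E) → P(D), ψ : f*D-style data) — the vertical-cartesian spans modulo vertical isomorphism of apexes). Then composition of such spans is well defined: given composable spans, the vertical leg of the second can be pulled back along the cartesian leg of the first, and the resulting composite is again a vertical-cartesian span; with this composition E^∨ is a category and the assignment on objects given by P defines a functor P^∨ : E^∨ → X. -/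
open CategoryTheory

variable {𝒳 𝒮 : Type*} [Category 𝒳] [Category 𝒮]

/-- A vertical–cartesian span `A ⟵ apex ⟶ B` in `𝒳` with respect to `P`:
the left leg is vertical (projects to an identity) and the right leg is
cartesian. These are the morphisms `A ⟶ B` of the dual category `𝒳^∨`. -/
structure VCSpan (P : 𝒳 ⥤ 𝒮) (A B : 𝒳) where
  apex : 𝒳
  vert : apex ⟶ A
  cart : apex ⟶ B
  vert_isVertical : P.IsHomLift (𝟙 (P.obj A)) vert
  cart_isCartesian : Functor.IsStronglyCartesian P (P.map cart) cart

/-- Two vertical–cartesian spans are equivalent if there is a vertical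
isomorphism of apexes commuting with both legs. -/
def VCSpanEquiv (P : 𝒳 ⥤ 𝒮) {A B : 𝒳} (s t : VCSpan P A B) : Prop :=
  ∃ θ : s.apex ≅ t.apex,
    P.IsHomLift (𝟙 (P.obj A)) θ.hom ∧ θ.hom ≫ t.vert = s.vert ∧ θ.hom ≫ t.cart = s.cart

/-- The identity span on `A`. -/
def idVCSpan (P : 𝒳 ⥤ 𝒮) (A : 𝒳) : VCSpan P A A where
  apex := A
  vert := 𝟙 A
  cart := 𝟙 A
  vert_isVertical := inferInstance
  cart_isCartesian := inferInstance

/-- `u` is a composite of the spans `s` and `t` if its apex is a pullback of the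
cartesian leg of `s` against the vertical leg of `t` (with vertical projection
opposite the vertical leg and cartesian projection opposite the cartesian leg),
and its legs are the induced composites. -/
def IsVCSpanComposite (P : 𝒳 ⥤ 𝒮) {A B C : 𝒳} (s : VCSpan P A B) (t : VCSpan P B C)
    (u : VCSpan P A C) : Prop :=
  ∃ (w₁ : u.apex ⟶ s.apex) (w₂ : u.apex ⟶ t.apex),
    IsPullback w₁ w₂ s.cart t.vert ∧ u.vert = w₁ ≫ s.vert ∧ u.cart = w₂ ≫ t.cart


theorem lift_cancel (P : 𝒳 ⥤ 𝒮) {R S T : 𝒮} {a b c : 𝒳} (f : R ⟶ S) (z : a ⟶ b) (w : b ⟶ c)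
    (hw : P.IsHomLift (𝟙 T) w) (h : P.IsHomLift f (z ≫ w)) : P.IsHomLift f z := by
  have h1 := IsHomLift.domain_eq P (𝟙 T) w
  have h2 := IsHomLift.codomain_eq P (𝟙 T) w
  have h3 := IsHomLift.domain_eq P f (z ≫ w)
  have h4 := IsHomLift.codomain_eq P f (z ≫ w)
  have e := IsHomLift.fac' P (𝟙 T) w
  have e2 := IsHomLift.fac P f (z ≫ w)
  refine IsHomLift.of_fac P f z h3 (h1.trans (h2.symm.trans h4)) ?_
  rw [e2, P.map_comp, e]
  simp

theorem vc_equiv_mk (P : 𝒳 ⥤ 𝒮) {A B : 𝒳} {s t : VCSpan P A B} (θ : s.apex ≅ t.apex)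
    (h1 : θ.hom ≫ t.vert = s.vert) (h2 : θ.hom ≫ t.cart = s.cart) : VCSpanEquiv P s t :=
  ⟨θ, lift_cancel P _ _ _ t.vert_isVertical (h1 ▸ s.vert_isVertical), h1, h2⟩

theorem cart_map (P : 𝒳 ⥤ 𝒮) {R S : 𝒮} {a b : 𝒳} (f : R ⟶ S) (φ : a ⟶ b)
    [h : P.IsStronglyCartesian f φ] : P.IsStronglyCartesian (P.map φ) φ := by
  subst_hom_lift P f φ
  exact h

theorem vc_exists (P : 𝒳 ⥤ 𝒮) (hP : IsFibration P) {A B C : 𝒳} (s : VCSpan P A B)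
    (t : VCSpan P B C) : ∃ u : VCSpan P A C, IsVCSpanComposite P s t u := by
  have := s.vert_isVertical
  have := t.vert_isVertical
  have := s.cart_isCartesian
  have := t.cart_isCartesian
  have e := IsHomLift.domain_eq P (𝟙 (P.obj B)) t.vert
  obtain ⟨c, φ, hφ⟩ := hP (P.map s.cart ≫ eqToHom e.symm)
  have l1 : P.IsHomLift (P.map s.cart) φ := by
    have : P.IsHomLift (P.map s.cart ≫ eqToHom e.symm) φ := inferInstance
    simpa using this
  have l2 : P.IsHomLift (P.map s.cart) (φ ≫ t.vert) := inferInstance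
  obtain ⟨w, ⟨hw1, hw2⟩, -⟩ := Functor.IsStronglyCartesian.universal_property P (P.map s.cart)
    s.cart (𝟙 _) (P.map s.cart) (by simp) (φ ≫ t.vert)
  have hφ' := cart_map P (P.map s.cart ≫ eqToHom e.symm) φ
  have hv : P.IsHomLift (𝟙 (P.obj A)) (w ≫ s.vert) :=
    IsHomLift.comp_lift_id_left' P (P.obj s.apex) w _ _
  refine ⟨⟨c, w ≫ s.vert, φ ≫ t.cart, hv, cart_map P (P.map φ ≫ P.map t.cart) _⟩, w, φ, ?_,
    rfl, rfl⟩
  have key : ∀ {d : 𝒳} (x : d ⟶ s.apex) (y : d ⟶ t.apex), x ≫ s.cart = y ≫ t.vert →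
      ∃! z : d ⟶ c, z ≫ w = x ∧ z ≫ φ = y := by
    intro d x y hxy
    have hy : P.IsHomLift (P.map x ≫ P.map s.cart) y := by
      refine lift_cancel P _ y t.vert t.vert_isVertical ?_
      rw [← hxy]; infer_instance
    have hy' : P.IsHomLift (P.map x ≫ P.map s.cart ≫ eqToHom e.symm) y := by
      rw [← Category.assoc]; infer_instance
    obtain ⟨z, ⟨hz1, hz2⟩, hz3⟩ := Functor.IsStronglyCartesian.universal_property P
      (P.map s.cart ≫ eqToHom e.symm) φ (P.map x) _ rfl y
    refine ⟨z, ⟨?_, hz2⟩, ?_⟩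
    · refine Functor.IsStronglyCartesian.ext P (P.map s.cart) s.cart (P.map x) ?_
      rw [Category.assoc, hw2, ← Category.assoc, hz2, hxy]
    · rintro z' ⟨h1, h2⟩
      refine hz3 z' ⟨lift_cancel P _ z' w hw1 ?_, h2⟩
      rw [h1]; infer_instance
  refine ⟨⟨hw2⟩, ⟨Limits.PullbackCone.IsLimit.mk _
    (fun q => (key q.fst q.snd q.condition).choose)
    (fun q => (key q.fst q.snd q.condition).choose_spec.1.1)
    (fun q => (key q.fst q.snd q.condition).choose_spec.1.2)
    (fun q m h1 h2 => (key q.fst q.snd q.condition).choose_spec.2 m ⟨h1, h2⟩)⟩⟩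

theorem vc_congr (P : 𝒳 ⥤ 𝒮) {A B C : 𝒳} {s s' : VCSpan P A B} {t t' : VCSpan P B C}
    {u u' : VCSpan P A C} (h : IsVCSpanComposite P s t u) (h' : IsVCSpanComposite P s' t' u')
    (hs : VCSpanEquiv P s s') (ht : VCSpanEquiv P t t') : VCSpanEquiv P u u' := by
  obtain ⟨w₁, w₂, hp, e1, e2⟩ := h
  obtain ⟨w₁', w₂', hp', e1', e2'⟩ := h'
  obtain ⟨θ, -, a1, a2⟩ := hs
  obtain ⟨η, -, b1, b2⟩ := ht
  have hq : IsPullback (w₁ ≫ θ.hom) (w₂ ≫ η.hom) s'.cart t'.vert :=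
    hp.of_iso (Iso.refl _) θ η (Iso.refl _) (by simp) (by simp) (by simp [a2]) (by simp [b1])
  refine vc_equiv_mk P (hq.isoIsPullback _ _ hp') ?_ ?_
  · rw [e1', e1, ← a1, IsPullback.isoIsPullback_hom_fst_assoc, Category.assoc]
  · rw [e2', e2, ← b2, IsPullback.isoIsPullback_hom_snd_assoc, Category.assoc]

theorem vc_assoc (P : 𝒳 ⥤ 𝒮) {A B C D : 𝒳} (s : VCSpan P A B) (t : VCSpan P B C)
    (u : VCSpan P C D) (st : VCSpan P A C) (tu : VCSpan P B D) (v w : VCSpan P A D)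
    (h1 : IsVCSpanComposite P s t st) (h2 : IsVCSpanComposite P st u v)
    (h3 : IsVCSpanComposite P t u tu) (h4 : IsVCSpanComposite P s tu w) :
    VCSpanEquiv P v w := by
  obtain ⟨w₁, w₂, hw, e1, e2⟩ := h1
  obtain ⟨r₁, r₂, hr, f1, f2⟩ := h2
  obtain ⟨p₁, p₂, hp, g1, g2⟩ := h3
  obtain ⟨q₁, q₂, hq, k1, k2⟩ := h4
  rw [e2] at hr
  rw [g1] at hq
  have hc : (r₁ ≫ w₂) ≫ t.cart = r₂ ≫ u.vert := by simpa using hr.w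
  have hl1 := hp.lift_fst _ _ hc
  have hl2 := hp.lift_snd _ _ hc
  have A1 : IsPullback r₁ (hp.lift _ _ hc) w₂ p₁ := IsPullback.of_bot' hr hp
  have A2 : IsPullback (r₁ ≫ w₁) (hp.lift _ _ hc) s.cart (p₁ ≫ t.vert) :=
    A1.paste_horiz hw
  refine vc_equiv_mk P (A2.isoIsPullback _ _ hq) ?_ ?_
  · rw [k1, f1, e1, IsPullback.isoIsPullback_hom_fst_assoc, Category.assoc]
  · rw [k2, g2, f2, IsPullback.isoIsPullback_hom_snd_assoc, ← Category.assoc, hl2]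

/-- For a Grothendieck fibration `P : 𝒳 ⥤ 𝒮`, composition of vertical–cartesian
spans (by pulling back the vertical leg of the second span along the cartesian
leg of the first) is well defined on equivalence classes, and makes the
collection `𝒳^∨` of objects of `𝒳` with equivalence classes of
vertical–cartesian spans as morphisms into a category; the assignment given by
`P` on objects (and on the base parts of spans) defines a functor
`P^∨ : 𝒳^∨ ⥤ 𝒮`. -/
theorem dual_category_well_defined (P : 𝒳 ⥤ 𝒮) (hP : IsFibration P) :
    -- the relation on spans is an equivalence relation
    (∀ A B : 𝒳, Equivalence (VCSpanEquiv P (A := A) (B := B))) ∧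
    -- composites of vertical–cartesian spans exist (and are again such spans)
    (∀ {A B C : 𝒳} (s : VCSpan P A B) (t : VCSpan P B C),
      ∃ u : VCSpan P A C, IsVCSpanComposite P s t u) ∧
    -- composition is well defined on equivalence classes
    (∀ {A B C : 𝒳} {s s' : VCSpan P A B} {t t' : VCSpan P B C} {u u' : VCSpan P A C},
      IsVCSpanComposite P s t u → IsVCSpanComposite P s' t' u' →
      VCSpanEquiv P s s' → VCSpanEquiv P t t' → VCSpanEquiv P u u') ∧
    -- identity spans are left and right units for this composition
    (∀ {A B : 𝒳} (s : VCSpan P A B), IsVCSpanComposite P (idVCSpan P A) s s) ∧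
    (∀ {A B : 𝒳} (s : VCSpan P A B), IsVCSpanComposite P s (idVCSpan P B) s) ∧
    -- composition is associative up to equivalence of spans
    (∀ {A B C D : 𝒳} (s : VCSpan P A B) (t : VCSpan P B C) (u : VCSpan P C D)
      (st : VCSpan P A C) (tu : VCSpan P B D) (v w : VCSpan P A D),
      IsVCSpanComposite P s t st → IsVCSpanComposite P st u v →
      IsVCSpanComposite P t u tu → IsVCSpanComposite P s tu w →
      VCSpanEquiv P v w) ∧
    -- `P` defines a functor on `𝒳^∨`: the base morphisms of spans are invariant
    -- under equivalence, identities lie over identities and composites lie over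
    -- composites
    (∀ {A B : 𝒳} {s s' : VCSpan P A B} (f : P.obj A ⟶ P.obj B),
      VCSpanEquiv P s s' → P.IsHomLift f s.cart → P.IsHomLift f s'.cart) ∧
    (∀ A : 𝒳, P.IsHomLift (𝟙 (P.obj A)) (idVCSpan P A).cart) ∧
    (∀ {A B C : 𝒳} (s : VCSpan P A B) (t : VCSpan P B C) (u : VCSpan P A C)
      (f : P.obj A ⟶ P.obj B) (g : P.obj B ⟶ P.obj C),
      P.IsHomLift f s.cart → P.IsHomLift g t.cart → IsVCSpanComposite P s t u →
      P.IsHomLift (f ≫ g) u.cart) := by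
  refine ⟨fun A B => ⟨?_, ?_, ?_⟩, vc_exists P hP, vc_congr P, ?_, ?_, vc_assoc P, ?_, ?_, ?_⟩
  · intro s
    exact vc_equiv_mk P (Iso.refl _) (by simp) (by simp)
  · rintro s t ⟨θ, -, h1, h2⟩
    exact vc_equiv_mk P θ.symm (by simp [← h1]) (by simp [← h2])
  · rintro s t r ⟨θ, -, h1, h2⟩ ⟨η, -, k1, k2⟩
    exact vc_equiv_mk P (θ ≪≫ η) (by simp [k1, h1]) (by simp [k2, h2])
  · intro A B s
    exact ⟨s.vert, 𝟙 _, IsPullback.of_id_snd, by simp [idVCSpan], by simp⟩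
  · intro A B s
    exact ⟨𝟙 _, s.cart, IsPullback.of_id_fst, by simp, by simp [idVCSpan]⟩
  · rintro A B s s' f ⟨θ, hθ, h1, h2⟩ hf
    have : s'.cart = θ.inv ≫ s.cart := by simp [← h2]
    rw [this]
    exact IsHomLift.comp_lift_id_left' P (P.obj A) _ _ _
  · intro A
    exact (inferInstance : P.IsHomLift (𝟙 (P.obj A)) (𝟙 A))
  · rintro A B C s t u f g hf hg ⟨w₁, w₂, hp, e1, e2⟩
    have hw1 : P.IsHomLift (𝟙 (P.obj A)) w₁ :=
      lift_cancel P _ _ _ s.vert_isVertical (e1 ▸ u.vert_isVertical)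
    have hw2 : P.IsHomLift f w₂ := by
      refine lift_cancel P _ _ _ t.vert_isVertical ?_
      rw [← hp.w]; infer_instance
    rw [e2]
    infer_instance
end

section
/- Let P : E → X and Q : D → X be Grothendieck fibrations and F : D → E a functor with F ⋙ P = Q. Then F sends Q-cartesian morphisms to P-cartesian morphisms if and only if: (i) for each object X of X, F restricts to a functor dF(X) : dQ(X) → dP(X) between the fibers (sending Q-vertical morphisms over X to P-vertical morphisms over X), and (ii) for every morphism f : X' → X of X the square of functors dQ(X) → dP(X) → dP(X') and dQ(X) → dQ(X') → dP(X') given by reindexing along f commutes up to the canonical natural isomorphism. -/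
open CategoryTheory

/-- Let `P : E ⥤ X` and `Q : D ⥤ X` be fibrations and `F : D ⥤ E` a functor over
`X` (i.e. `F ⋙ P = Q`). Then `F` sends `Q`-cartesian morphisms to `P`-cartesian
morphisms if and only if (i) `F` restricts, for every object `S` of `X`, to a
functor between the fibers over `S` (it sends `Q`-vertical morphisms over `S` to
`P`-vertical morphisms over `S`), and (ii) for every `f : R ⟶ S` the square of
reindexing functors between the fibers commutes up to the canonical natural
isomorphism: the canonical vertical comparison morphism
`χ : F(f*a) ⟶ f*(F a)` — the unique vertical morphism with `χ ≫ θ = F(ψ)` for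
`ψ : f*a ⟶ a` a `Q`-cartesian lift of `f` and `θ : f*(F a) ⟶ F a` a
`P`-cartesian lift of `f` — is an isomorphism. -/
theorem preserves_cartesian_iff_fiberwise {D E X : Type*}
    [Category D] [Category E] [Category X]
    (P : E ⥤ X) (Q : D ⥤ X) (hP : IsFibration P) (hQ : IsFibration Q)
    (F : D ⥤ E) (hF : F ⋙ P = Q) :
    (∀ {a b : D} {R S : X} (f : R ⟶ S) (φ : a ⟶ b),
        Functor.IsStronglyCartesian Q f φ → Functor.IsStronglyCartesian P f (F.map φ)) ↔
    ((∀ {a b : D} {S : X} (φ : a ⟶ b),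
        Q.IsHomLift (𝟙 S) φ → P.IsHomLift (𝟙 S) (F.map φ)) ∧
      (∀ {R S : X} (f : R ⟶ S) {a' a : D} (ψ : a' ⟶ a),
        Functor.IsStronglyCartesian Q f ψ →
        ∀ {e' : E} (θ : e' ⟶ F.obj a), Functor.IsStronglyCartesian P f θ →
        ∀ (χ : F.obj a' ⟶ e'), P.IsHomLift (𝟙 R) χ → χ ≫ θ = F.map ψ → IsIso χ)) := by
  subst hF
  have hlift : ∀ {a b : D} {R S : X} (f : R ⟶ S) (φ : a ⟶ b),
      (F ⋙ P).IsHomLift f φ → P.IsHomLift f (F.map φ) := by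
    intro a b R S f φ h
    obtain ⟨⟩ := h
    exact Functor.IsHomLift.map (F.map φ)
  constructor
  · intro H
    refine ⟨fun φ h => hlift _ φ h, ?_⟩
    intro R S f a' a ψ hψ e' θ hθ χ hχ e
    have h1 : P.IsStronglyCartesian f (F.map ψ) := H f ψ hψ
    have h2 : P.IsStronglyCartesian (𝟙 R ≫ f) (χ ≫ θ) := by
      rw [e, Category.id_comp]; exact h1
    have h3 : P.IsStronglyCartesian (𝟙 R) χ :=
      Functor.IsStronglyCartesian.of_comp P (f := 𝟙 R) (g := f) (φ := χ) (ψ := θ)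
    exact Functor.IsStronglyCartesian.isIso_of_base_isIso P (𝟙 R) χ
  · rintro ⟨-, H⟩ a b R S f φ hφ
    have h0 : P.IsHomLift f (F.map φ) := hlift f φ hφ.toIsHomLift
    obtain rfl : P.obj (F.obj b) = S := IsHomLift.codomain_eq P f (F.map φ)
    obtain ⟨e', θ, hθ⟩ := hP f
    have hfac : f = 𝟙 R ≫ f := (Category.id_comp f).symm
    have hχ := Functor.IsStronglyCartesian.map_isHomLift P f θ hfac (F.map φ)
    have he := Functor.IsStronglyCartesian.fac P f θ hfac (F.map φ)
    have hi := H f φ hφ θ hθ _ hχ he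
    have hc := Functor.IsStronglyCartesian.of_isIso P (𝟙 R)
      (Functor.IsStronglyCartesian.map P f θ hfac (F.map φ))
    have : P.IsStronglyCartesian (𝟙 R ≫ f)
      (Functor.IsStronglyCartesian.map P f θ hfac (F.map φ) ≫ θ) := inferInstance
    rw [he, Category.id_comp] at this
    exact this
end
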